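/- Let (V, g, p) be a d-dimensional geometric constraint system: g : (ℝ^d)^n → ℝ^m has polynomial components invariant under Euclidean isometries of ℝ^d, and g(p) = 0. Let ℓ be the dimension of the affine span of {p_1,…,p_n}. If the system is infinitesimally rigid, then p is a regular point of the constraint set: there exists an open neighborhood U of p in (ℝ^d)^n such that g^{-1}(0) ∩ U is a smooth embedded submanifold of (ℝ^d)^n of dimension (ℓ+1)(2d−ℓ)/2. -/

import Mathlib

open scoped BigOperators Matrix

section SliceChart

open Topology ContDiff

/-- Every linear map between finite-dimensional spaces has a generalized inverse. -/
theorem exists_generalizedInverse {E F : Type*}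
    [AddCommGroup E] [Module ℝ E] [AddCommGroup F] [Module ℝ F] (A : E →ₗ[ℝ] F) :
    ∃ B : F →ₗ[ℝ] E, ∀ x, A (B (A x)) = A x := by
  obtain ⟨s, hs⟩ := A.rangeRestrict.exists_rightInverse_of_surjective A.range_rangeRestrict
  obtain ⟨r, hr⟩ := (LinearMap.range A).subtype.exists_leftInverse_of_injective
    (Submodule.ker_subtype _)
  refine ⟨s ∘ₗ r, fun x => ?_⟩
  have h1 : r (A x) = A.rangeRestrict x := LinearMap.congr_fun hr (A.rangeRestrict x)
  have h2 := LinearMap.congr_fun hs (A.rangeRestrict x)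
  simp only [LinearMap.comp_apply, h1]
  exact congrArg Subtype.val h2

/-- If the zero set of an analytic map `f` contains the image of a map `γ` whose derivative
covers the kernel of the derivative of `f`, then the zero set is a submanifold near `γ 0`,
modelled on that kernel. -/
theorem exists_sliceChart_of_ker_le_range {E F W : Type*}
    [NormedAddCommGroup E] [NormedSpace ℝ E] [FiniteDimensional ℝ E]
    [NormedAddCommGroup F] [NormedSpace ℝ F] [FiniteDimensional ℝ F]
    [NormedAddCommGroup W] [NormedSpace ℝ W] [FiniteDimensional ℝ W]
    {f : E → F} {A : E →L[ℝ] F} {γ : W → E} {L : W →L[ℝ] E}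
    (hf : ContDiff ℝ ω f) (hA : HasFDerivAt f A (γ 0)) (hγ : HasStrictFDerivAt γ L 0)
    (hfγ : ∀ w, f (γ w) = 0) (hker : ∀ v, A v = 0 → ∃ w, L w = v) :
    ∃ U : Set E, IsOpen U ∧ γ 0 ∈ U ∧ ∃ φ : PartialHomeomorph E E,
      φ.source = U ∧ ContDiffOn ℝ (⊤ : ℕ∞) φ U ∧ ContDiffOn ℝ (⊤ : ℕ∞) φ.symm φ.target ∧
      φ '' {x | x ∈ U ∧ f x = 0} = φ.target ∩ (LinearMap.ker A.toLinearMap : Set E) := by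
  have := FiniteDimensional.complete ℝ E
  have := FiniteDimensional.complete ℝ W
  obtain ⟨B₀, hB₀⟩ := exists_generalizedInverse A.toLinearMap
  let B : F →L[ℝ] E := B₀.toContinuousLinearMap
  have hB : ∀ x, A (B (A x)) = A x := hB₀
  set K := LinearMap.ker A.toLinearMap with hK
  have memK : ∀ x, x ∈ K ↔ A x = 0 := fun x => LinearMap.mem_ker
  let ψ : E → E := fun x => (x - γ 0) + B (f x - A (x - γ 0))
  have hψ_cd : ContDiff ℝ ω ψ := by fun_prop
  have hψ_fd :
      HasFDerivAt ψ ((ContinuousLinearEquiv.refl ℝ E : E ≃L[ℝ] E) : E →L[ℝ] E) (γ 0) := by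
    have h1 : HasFDerivAt (fun x => x - γ 0) (ContinuousLinearMap.id ℝ E) (γ 0) :=
      (hasFDerivAt_id _).sub_const _
    have h2 := h1.add (B.hasFDerivAt.comp (γ 0) (hA.sub (A.hasFDerivAt.comp (γ 0) h1)))
    refine h2.congr_fderiv ?_
    ext v
    simp
  have hψ_zero : ∀ x, f x = 0 → ψ x ∈ K := by
    intro x hx
    rw [memK]
    simp [ψ, hx, hB, -map_sub]
  have hψ_at : ψ (γ 0) = 0 := by simp [ψ, hfγ]
  have hω : (ω : WithTop ℕ∞) ≠ 0 := by simp
  let e := hψ_cd.contDiffAt.toOpenPartialHomeomorph ψ hψ_fd hω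
  have he : ∀ x, e x = ψ x := fun _ => rfl
  have hmem : γ 0 ∈ e.source := hψ_cd.contDiffAt.mem_toOpenPartialHomeomorph_source hψ_fd hω
  have hsymm : ContDiffAt ℝ ω e.symm (ψ (γ 0)) := hψ_cd.contDiffAt.to_localInverse hψ_fd hω
  -- Points of the kernel near `0` are hit by `ψ ∘ γ`.
  obtain ⟨π₀, hπ₀⟩ := K.subtype.exists_leftInverse_of_injective (Submodule.ker_subtype _)
  let π : E →L[ℝ] K := π₀.toContinuousLinearMap
  have hπ : ∀ y : K, π y = y := fun y => LinearMap.congr_fun hπ₀ y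
  have hψ_sfd : HasStrictFDerivAt ψ (ContinuousLinearMap.id ℝ E) (γ 0) :=
    hψ_cd.contDiffAt.hasStrictFDerivAt' hψ_fd hω
  have hcomp : HasStrictFDerivAt (fun w => π (ψ (γ w)))
      (π.comp ((ContinuousLinearMap.id ℝ E).comp L)) 0 :=
    π.hasStrictFDerivAt.comp 0 (hψ_sfd.comp 0 hγ)
  have hsurj : (π.comp ((ContinuousLinearMap.id ℝ E).comp L)).range = ⊤ := by
    rw [LinearMap.range_eq_top]
    intro y
    obtain ⟨w, hw⟩ := hker y ((memK _).1 y.2)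
    exact ⟨w, by simp [hw, hπ]⟩
  have hnhds := hcomp.map_nhds_eq_of_surj hsurj
  have hγ_mem : ∀ᶠ w in 𝓝 (0 : W), γ w ∈ e.source :=
    hγ.continuousAt.eventually (e.open_source.mem_nhds hmem)
  have hhit : ∀ᶠ y in 𝓝 (ψ (γ 0)), ∃ w, γ w ∈ e.source ∧ π (ψ (γ w)) = π y := by
    have : ∀ᶠ z in 𝓝 (π (ψ (γ 0))), ∃ w, γ w ∈ e.source ∧ π (ψ (γ w)) = z := by
      rw [← hnhds, Filter.eventually_map]
      exact hγ_mem.mono fun w hw => ⟨w, hw, rfl⟩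
    exact π.continuous.continuousAt.eventually this
  obtain ⟨N, hN, hNo, hNm⟩ := eventually_nhds_iff.1 (hhit.and (hsymm.eventually (by simp)))
  let e' := (e.symm.restrOpen N hNo).symm
  have hsrc : ∀ x, x ∈ e'.source ↔ x ∈ e.source ∧ ψ x ∈ N := by
    intro x
    change x ∈ e.source ∩ e.symm.symm ⁻¹' N ↔ _
    simp [he]
  have htgt : ∀ y, y ∈ e'.target ↔ y ∈ e.target ∧ y ∈ N := fun y => Iff.rfl
  have he' : ∀ x, e'.toPartialHomeomorph x = ψ x := fun _ => rfl
  refine ⟨e'.source, e'.open_source, (hsrc _).2 ⟨hmem, hNm⟩, e'.toPartialHomeomorph, rfl,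
    (hψ_cd.of_le (by simp)).contDiffOn, fun y hy => ?_, ?_⟩
  · exact ((hN y ((htgt y).1 hy).2).2.of_le (by simp)).contDiffWithinAt
  · ext y
    constructor
    · rintro ⟨x, ⟨hxs, hx0⟩, rfl⟩
      exact ⟨e'.map_source hxs, hψ_zero x hx0⟩
    · rintro ⟨hyt, hyK⟩
      obtain ⟨w, hw, hwy⟩ := (hN y ((htgt y).1 hyt).2).1
      have hwK : ψ (γ w) ∈ K := hψ_zero _ (hfγ w)
      have hy : ψ (γ w) = y := by
        have := congrArg Subtype.val hwy
        rwa [hπ ⟨_, hwK⟩, hπ ⟨_, hyK⟩] at this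
      exact ⟨γ w, ⟨(hsrc _).2 ⟨hw, hy ▸ ((htgt y).1 hyt).2⟩, hfγ w⟩, hy⟩

end SliceChart

section SkewDimension

/-- The space of skew-symmetric real matrices of size `k`. -/
def skewMatrices (k : ℕ) : Submodule ℝ (Matrix (Fin k) (Fin k) ℝ) where
  carrier := {S | Sᵀ = -S}
  add_mem' := by
    intro S T hS hT
    simp only [Set.mem_ofPred_eq, Matrix.transpose_add] at *
    rw [hS, hT]; abel
  zero_mem' := by simp
  smul_mem' := by
    intro c S hS
    simp only [Set.mem_ofPred_eq, Matrix.transpose_smul] at *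
    rw [hS, smul_neg]

theorem mem_skewMatrices {k : ℕ} {S : Matrix (Fin k) (Fin k) ℝ} :
    S ∈ skewMatrices k ↔ Sᵀ = -S := Iff.rfl

/-- A skew-symmetric matrix is determined by its entries below the diagonal. -/
def skewMatricesEquiv (k : ℕ) : skewMatrices k ≃ₗ[ℝ] ((j : Fin k) → Fin j → ℝ) where
  toFun S j i := S.1 j ⟨i, i.2.trans j.2⟩
  map_add' _ _ := rfl
  map_smul' _ _ := rfl
  invFun u := ⟨Matrix.of fun a b =>
      if h : b < a then u a ⟨b, h⟩ else if h : a < b then -u b ⟨a, h⟩ else 0, by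
    rw [mem_skewMatrices]
    ext a b
    rcases lt_trichotomy a b with h | h | h
    · simp [h, h.not_gt]
    · simp [h]
    · simp [h, h.not_gt]⟩
  left_inv S := by
    obtain ⟨S, hS⟩ := S
    have hS' : ∀ a b, S a b = -S b a := fun a b => by
      simpa using congrFun (congrFun hS b) a
    ext a b
    rcases lt_trichotomy a b with h | h | h
    · simpa [h, h.not_gt] using (hS' a b).symm
    · subst h
      have := hS' a a
      simp only [lt_self_iff_false, dite_false, Matrix.of_apply]
      linarith
    · simp [h]
  right_inv u := by
    ext j i
    have h : (⟨i, i.2.trans j.2⟩ : Fin k) < j := i.2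
    simp [h]

theorem two_mul_finrank_skewMatrices (k : ℕ) :
    Module.finrank ℝ (skewMatrices k) * 2 = k * (k - 1) := by
  rw [(skewMatricesEquiv k).finrank_eq, Module.finrank_pi_fintype]
  simp only [Module.finrank_fin_fun]
  rw [Fin.sum_univ_eq_sum_range (fun j => j) k, Finset.sum_range_id_mul_two]

/-- The skew-symmetric matrices vanishing on a subspace `D`. -/
def skewMatricesVanishingOn {d : ℕ} (D : Submodule ℝ (Fin d → ℝ)) :
    Submodule ℝ (Matrix (Fin d) (Fin d) ℝ) where
  carrier := {S | Sᵀ = -S ∧ ∀ v ∈ D, S.mulVec v = 0}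
  add_mem' := by
    rintro S T ⟨hS, hS'⟩ ⟨hT, hT'⟩
    exact ⟨(skewMatrices d).add_mem hS hT, fun v hv => by
      rw [Matrix.add_mulVec, hS' v hv, hT' v hv, add_zero]⟩
  zero_mem' := by simp
  smul_mem' := by
    rintro c S ⟨hS, hS'⟩
    exact ⟨(skewMatrices d).smul_mem c hS, fun v hv => by
      rw [Matrix.smul_mulVec, hS' v hv, smul_zero]⟩

theorem finrank_skewMatricesVanishingOn {d : ℕ} (D : Submodule ℝ (Fin d → ℝ)) :
    Module.finrank ℝ (skewMatricesVanishingOn D) =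
      Module.finrank ℝ (skewMatrices (d - Module.finrank ℝ D)) := by
  set k := d - Module.finrank ℝ D with hk
  have hquot : Module.finrank ℝ ((Fin d → ℝ) ⧸ D) = k := by
    have := D.finrank_quotient_add_finrank
    rw [Module.finrank_fin_fun] at this
    omega
  let eq : ((Fin d → ℝ) ⧸ D) ≃ₗ[ℝ] (Fin k → ℝ) :=
    LinearEquiv.ofFinrankEq _ _ (by rw [hquot, Module.finrank_fin_fun])
  let c : (Fin d → ℝ) →ₗ[ℝ] (Fin k → ℝ) := eq.toLinearMap ∘ₗ D.mkQ
  have hc_ker : ∀ v, c v = 0 ↔ v ∈ D := fun v => by simp [c]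
  have hc_surj : LinearMap.range c = ⊤ :=
    LinearMap.range_eq_top.2 (eq.surjective.comp D.mkQ_surjective)
  obtain ⟨r, hr⟩ := c.exists_rightInverse_of_surjective hc_surj
  let C := LinearMap.toMatrix' c
  let R := LinearMap.toMatrix' r
  have hCR : C * R = 1 := by
    rw [← LinearMap.toMatrix'_comp, hr, LinearMap.toMatrix'_id]
  have hRC : Rᵀ * Cᵀ = 1 := by
    rw [← Matrix.transpose_mul, hCR, Matrix.transpose_one]
  have hC_mulVec : ∀ v, C.mulVec v = c v := fun v => by
    rw [← Matrix.toLin'_apply, Matrix.toLin'_toMatrix']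
  symm
  refine LinearEquiv.finrank_eq (LinearEquiv.ofBijective
    ({ toFun := fun M => ⟨Cᵀ * M.1 * C, ?_, ?_⟩
       map_add' := ?_
       map_smul' := ?_ } : skewMatrices k →ₗ[ℝ] skewMatricesVanishingOn D) ⟨?_, ?_⟩)
  · simp [Matrix.transpose_mul, mem_skewMatrices.1 M.2, Matrix.mul_assoc]
  · intro v hv
    rw [← Matrix.mulVec_mulVec, hC_mulVec, (hc_ker v).2 hv, Matrix.mulVec_zero]
  · intro M N
    ext1
    simp [Matrix.mul_add, Matrix.add_mul]
  · intro a M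
    ext1
    simp
  · intro M N h
    have h1 : Cᵀ * M.1 * C = Cᵀ * N.1 * C := congrArg Subtype.val h
    have h2 : ∀ X : Matrix (Fin k) (Fin k) ℝ, Rᵀ * (Cᵀ * X * C) * R = X := fun X => by
      calc Rᵀ * (Cᵀ * X * C) * R = (Rᵀ * Cᵀ) * X * (C * R) := by simp only [Matrix.mul_assoc]
        _ = X := by rw [hRC, hCR, one_mul, mul_one]
    ext1
    rw [← h2 M.1, h1, h2]
  · rintro ⟨S, hS, hSD⟩
    have hSRC : S * (R * C) = S := by
      apply Matrix.toLin'.injective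
      ext1 v
      have hmem : (R * C).mulVec (Pi.single v 1) - Pi.single v 1 ∈ D := by
        rw [← hc_ker, ← hC_mulVec, Matrix.mulVec_sub, Matrix.mulVec_mulVec, ← Matrix.mul_assoc,
          hCR, Matrix.one_mul, sub_self]
      have := hSD _ hmem
      rw [Matrix.mulVec_sub, sub_eq_zero, Matrix.mulVec_mulVec] at this
      ext1
      simpa only [LinearMap.comp_apply, LinearMap.single_apply, Matrix.toLin'_apply] using this
    have hCRS : Cᵀ * Rᵀ * S = S := by
      have := congrArg Matrix.transpose hSRC
      rw [Matrix.transpose_mul, Matrix.transpose_mul, hS, mul_neg, neg_inj] at this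
      exact this
    refine ⟨⟨Rᵀ * S * R, ?_⟩, ?_⟩
    · simp [mem_skewMatrices, Matrix.transpose_mul, hS, Matrix.mul_assoc]
    · ext1
      change Cᵀ * (Rᵀ * S * R) * C = S
      calc Cᵀ * (Rᵀ * S * R) * C = (Cᵀ * Rᵀ * S) * (R * C) := by simp only [Matrix.mul_assoc]
        _ = S := by rw [hCRS, hSRC]

end SkewDimension

section TrivialFlexes

variable {d n : ℕ}

/-- The linear map sending `(S, τ)` to the flex `i ↦ S p_i + τ`. -/
def affineFlex (p : Fin n → Fin d → ℝ) :
    Matrix (Fin d) (Fin d) ℝ × (Fin d → ℝ) →ₗ[ℝ] (Fin n → Fin d → ℝ) where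
  toFun w i := w.1.mulVec (p i) + w.2
  map_add' v w := by
    ext1 i
    simp only [Prod.fst_add, Prod.snd_add, Matrix.add_mulVec, Pi.add_apply]
    abel
  map_smul' c w := by
    ext1 i
    simp [Matrix.smul_mulVec]

theorem affineFlex_apply (p : Fin n → Fin d → ℝ)
    (w : Matrix (Fin d) (Fin d) ℝ × (Fin d → ℝ)) (i : Fin n) :
    affineFlex p w i = w.1.mulVec (p i) + w.2 := rfl

/-- The space of trivial flexes of the configuration `p`. -/
def trivialFlexes (p : Fin n → Fin d → ℝ) : Submodule ℝ (Fin n → Fin d → ℝ) :=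
  ((skewMatrices d).prod ⊤).map (affineFlex p)

theorem mem_trivialFlexes {p v : Fin n → Fin d → ℝ} :
    v ∈ trivialFlexes p ↔ ∃ (S : Matrix (Fin d) (Fin d) ℝ) (τ : Fin d → ℝ),
      Sᵀ = -S ∧ ∀ i, v i = S.mulVec (p i) + τ := by
  constructor
  · rintro ⟨w, ⟨hw, -⟩, rfl⟩
    exact ⟨w.1, w.2, hw, fun i => rfl⟩
  · rintro ⟨S, τ, hS, h⟩
    exact ⟨(S, τ), ⟨hS, Submodule.mem_top⟩, funext fun i => (h i).symm⟩

theorem finrank_trivialFlexes (hn : 0 < n) (p : Fin n → Fin d → ℝ) :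
    Module.finrank ℝ (trivialFlexes p) =
      (Module.finrank ℝ (affineSpan ℝ (Set.range p)).direction + 1) *
        (2 * d - Module.finrank ℝ (affineSpan ℝ (Set.range p)).direction) / 2 := by
  set D := (affineSpan ℝ (Set.range p)).direction with hD
  set ℓ := Module.finrank ℝ D with hℓ
  have hℓd : ℓ ≤ d := by simpa using D.finrank_le
  have hDspan : D = Submodule.span ℝ (Set.range fun i => p i - p ⟨0, hn⟩) := by
    rw [hD, direction_affineSpan, vectorSpan_range_eq_span_range_vsub_right ℝ p ⟨0, hn⟩]
    rfl
  let f := (affineFlex p).domRestrict ((skewMatrices d).prod ⊤)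
  have hrange : LinearMap.range f = trivialFlexes p := LinearMap.range_domRestrict _ _
  have hker : Module.finrank ℝ (LinearMap.ker f) =
      Module.finrank ℝ (skewMatricesVanishingOn D) := by
    refine LinearEquiv.finrank_eq (LinearEquiv.ofBijective
      ({ toFun := fun w => ⟨w.1.1.1, w.1.2.1, ?_⟩
         map_add' := fun _ _ => rfl
         map_smul' := fun _ _ => rfl } : LinearMap.ker f →ₗ[ℝ] skewMatricesVanishingOn D)
      ⟨?_, ?_⟩)
    · have hw : ∀ i, w.1.1.1.mulVec (p i) + w.1.1.2 = 0 := congrFun (LinearMap.mem_ker.1 w.2)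
      suffices D ≤ LinearMap.ker (Matrix.toLin' w.1.1.1) from fun v hv => this hv
      rw [hDspan, Submodule.span_le]
      rintro _ ⟨i, rfl⟩
      change w.1.1.1.mulVec (p i - p ⟨0, hn⟩) = 0
      rw [Matrix.mulVec_sub, ← add_sub_add_right_eq_sub _ _ w.1.1.2, hw, hw, sub_self]
    · intro v w h
      have h1 : v.1.1.1 = w.1.1.1 := congrArg Subtype.val h
      have hv : v.1.1.1.mulVec (p ⟨0, hn⟩) + v.1.1.2 = 0 := congrFun (LinearMap.mem_ker.1 v.2) _
      have hw : w.1.1.1.mulVec (p ⟨0, hn⟩) + w.1.1.2 = 0 := congrFun (LinearMap.mem_ker.1 w.2) _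
      have h2 : v.1.1.2 = w.1.1.2 := by
        rw [← h1, ← hv] at hw
        exact (add_left_cancel hw).symm
      exact Subtype.ext (Subtype.ext (Prod.ext h1 h2))
    · rintro ⟨S, hS, hSD⟩
      refine ⟨⟨⟨(S, -S.mulVec (p ⟨0, hn⟩)), hS, Submodule.mem_top⟩, ?_⟩, rfl⟩
      rw [LinearMap.mem_ker]
      ext1 i
      change S.mulVec (p i) + -S.mulVec (p ⟨0, hn⟩) = 0
      rw [← sub_eq_add_neg, ← Matrix.mulVec_sub]
      exact hSD _ (hDspan ▸ Submodule.subset_span ⟨i, rfl⟩)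
  have hdom : Module.finrank ℝ ((skewMatrices d).prod (⊤ : Submodule ℝ (Fin d → ℝ))) =
      Module.finrank ℝ (skewMatrices d) + d := by
    rw [LinearEquiv.finrank_eq (N := skewMatrices d × (Fin d → ℝ))
      { toFun := fun x => ((⟨x.1.1, x.2.1⟩ : skewMatrices d), x.1.2)
        map_add' := fun _ _ => rfl
        map_smul' := fun _ _ => rfl
        invFun := fun y => ⟨(y.1.1, y.2), y.1.2, Submodule.mem_top⟩
        left_inv := fun _ => rfl
        right_inv := fun _ => rfl }, Module.finrank_prod, Module.finrank_fin_fun]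
  have hrn := f.finrank_range_add_finrank_ker
  rw [hrange, hker, finrank_skewMatricesVanishingOn, hdom] at hrn
  have h1 := two_mul_finrank_skewMatrices d
  have h2 := two_mul_finrank_skewMatrices (d - ℓ)
  symm
  apply Nat.div_eq_of_eq_mul_left two_pos
  have hsq : ∀ k : ℕ, k * (k - 1) + k = k * k := fun k => by cases k <;> simp [Nat.mul_succ]
  have h3 := hsq d
  have h4 := hsq (d - ℓ)
  obtain ⟨k, hk⟩ := Nat.exists_eq_add_of_le hℓd
  have hk1 : d - ℓ = k := by omega
  have hk2 : 2 * d - ℓ = ℓ + 2 * k := by omega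
  rw [hk1] at h2 h4 hrn
  rw [hk2]
  rw [← h1] at h3
  rw [← h2] at h4
  generalize Module.finrank ℝ (skewMatrices d) = a at *
  generalize Module.finrank ℝ (skewMatrices k) = b at *
  generalize Module.finrank ℝ (trivialFlexes p) = t at *
  clear_value ℓ
  subst hk
  nlinarith

end TrivialFlexes

section Orbit

open scoped Matrix.Norms.Operator

variable {d n : ℕ}

/-- The exponential of a skew-symmetric matrix is orthogonal. -/
theorem transpose_exp_mul_exp_of_skew {S : Matrix (Fin d) (Fin d) ℝ} (hS : Sᵀ = -S) :
    (NormedSpace.exp S)ᵀ * NormedSpace.exp S = 1 := by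
  rw [← Matrix.exp_transpose, hS, Matrix.exp_neg,
    Matrix.nonsing_inv_mul _ ((Matrix.isUnit_iff_isUnit_det _).1 (Matrix.isUnit_exp S))]

theorem transpose_sub_transpose (M : Matrix (Fin d) (Fin d) ℝ) : (M - Mᵀ)ᵀ = -(M - Mᵀ) := by
  simp

/-- The isometry orbit of `p`, parametrized by the exponential. -/
noncomputable def orbitMap (p : Fin n → Fin d → ℝ)
    (w : Matrix (Fin d) (Fin d) ℝ × (Fin d → ℝ)) : Fin n → Fin d → ℝ :=
  affineFlex p (NormedSpace.exp (w.1 - w.1ᵀ), w.2)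

theorem orbitMap_zero (p : Fin n → Fin d → ℝ) : orbitMap p 0 = p := by
  ext1 i
  simp [orbitMap, affineFlex_apply]

/-- The antisymmetrization `(M, τ) ↦ (M - Mᵀ, τ)`. -/
def antisymmetrization (d : ℕ) : Matrix (Fin d) (Fin d) ℝ × (Fin d → ℝ) →ₗ[ℝ]
    Matrix (Fin d) (Fin d) ℝ × (Fin d → ℝ) where
  toFun w := (w.1 - w.1ᵀ, w.2)
  map_add' v w := by
    ext1
    · simp only [Prod.fst_add, Matrix.transpose_add]; abel
    · rfl
  map_smul' c w := by
    ext1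
    · simp [smul_sub]
    · rfl

theorem hasStrictFDerivAt_orbitMap (p : Fin n → Fin d → ℝ) :
    HasStrictFDerivAt (orbitMap p)
      (affineFlex p ∘ₗ antisymmetrization d).toContinuousLinearMap 0 := by
  have h1 : HasStrictFDerivAt
      (fun w : Matrix (Fin d) (Fin d) ℝ × (Fin d → ℝ) => (NormedSpace.exp w.1, w.2))
      (ContinuousLinearMap.id ℝ _) (antisymmetrization d 0) := by
    rw [map_zero]
    have h2 : HasStrictFDerivAt (NormedSpace.exp : Matrix (Fin d) (Fin d) ℝ → _)
        (1 : Matrix (Fin d) (Fin d) ℝ →L[ℝ] _)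
        (0 : Matrix (Fin d) (Fin d) ℝ × (Fin d → ℝ)).1 := hasStrictFDerivAt_exp_zero
    exact (h2.comp (0 : Matrix (Fin d) (Fin d) ℝ × (Fin d → ℝ)) hasStrictFDerivAt_fst).prodMk
      hasStrictFDerivAt_snd
  exact (affineFlex p).toContinuousLinearMap.hasStrictFDerivAt.comp 0
    (h1.comp 0 (antisymmetrization d).toContinuousLinearMap.hasStrictFDerivAt)

theorem exists_antisymmetrization_of_mem_trivialFlexes {p v : Fin n → Fin d → ℝ}
    (hv : v ∈ trivialFlexes p) : ∃ w, affineFlex p (antisymmetrization d w) = v := by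
  obtain ⟨⟨S, τ⟩, ⟨hS, -⟩, rfl⟩ := hv
  refine ⟨((1 / 2 : ℝ) • S, τ), ?_⟩
  congr 1
  have hS : Sᵀ = -S := hS
  ext1
  · change (1 / 2 : ℝ) • S - ((1 / 2 : ℝ) • S)ᵀ = S
    rw [Matrix.transpose_smul, hS]
    module
  · rfl

end Orbit

section Main

open ContDiff Matrix.Norms.Operator

theorem contDiff_of_eq_eval {d n m : ℕ} {g : (Fin n → Fin d → ℝ) → Fin m → ℝ}
    {P : Fin m → MvPolynomial (Fin n × Fin d) ℝ}
    (hP : ∀ x i, g x i = MvPolynomial.eval (fun v => x v.1 v.2) (P i)) : ContDiff ℝ ω g := by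
  rw [contDiff_pi]
  intro i
  have h : AnalyticOnNhd ℝ (fun x : Fin n → Fin d → ℝ =>
      MvPolynomial.aeval (fun v : Fin n × Fin d => x v.1 v.2) (P i)) Set.univ := by
    refine AnalyticOnNhd.aeval_mvPolynomial (fun v => ?_) (P i)
    exact ((ContinuousLinearMap.proj (R := ℝ) (φ := fun _ : Fin d => ℝ) v.2).comp
      (ContinuousLinearMap.proj (R := ℝ) (φ := fun _ : Fin n => Fin d → ℝ) v.1)).analyticOnNhd _
  simpa [hP, MvPolynomial.aeval_eq_eval] using h.contDiff

/-- If a `d`-dimensional geometric constraint system `(V, g, p)` is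
infinitesimally rigid, then `p` is a regular point of the constraint set: there is an
open neighborhood `U` of `p` such that `g⁻¹(0) ∩ U` is a smooth embedded submanifold of
`(ℝ^d)^n` of dimension `(ℓ+1)(2d−ℓ)/2`, witnessed by a smooth slice chart `φ` carrying
`g⁻¹(0) ∩ U` onto the intersection of its target with a linear subspace `T` of that
dimension. -/
theorem inf_rigid_regular_point
    (d n m : ℕ) (hn : 0 < n)
    (g : (Fin n → Fin d → ℝ) → Fin m → ℝ)
    -- the components of g are polynomials
    (hpoly : ∃ P : Fin m → MvPolynomial (Fin n × Fin d) ℝ,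
      ∀ (x : Fin n → Fin d → ℝ) (i : Fin m),
        g x i = MvPolynomial.eval (fun v => x v.1 v.2) (P i))
    -- g is invariant under Euclidean isometries of ℝ^d
    (hinv : ∀ (Q : Matrix (Fin d) (Fin d) ℝ), Qᵀ * Q = 1 → ∀ (τ : Fin d → ℝ),
      ∀ x : Fin n → Fin d → ℝ, g (fun i => Q.mulVec (x i) + τ) = g x)
    (p : Fin n → Fin d → ℝ) (hp : g p = 0)
    (ℓ : ℕ)
    (hℓ : ℓ = Module.finrank ℝ (affineSpan ℝ (Set.range p)).direction)
    -- infinitesimal rigidity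
    (hinfrig : ∀ v : Fin n → Fin d → ℝ, fderiv ℝ g p v = 0 →
      ∃ (S : Matrix (Fin d) (Fin d) ℝ) (τ : Fin d → ℝ),
        Sᵀ = -S ∧ ∀ i, v i = S.mulVec (p i) + τ) :
    ∃ U : Set (Fin n → Fin d → ℝ), IsOpen U ∧ p ∈ U ∧
      ∃ (φ : PartialHomeomorph (Fin n → Fin d → ℝ) (Fin n → Fin d → ℝ))
        (T : Submodule ℝ (Fin n → Fin d → ℝ)),
        φ.source = U ∧
        ContDiffOn ℝ (⊤ : ℕ∞) φ U ∧
        ContDiffOn ℝ (⊤ : ℕ∞) φ.symm φ.target ∧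
        Module.finrank ℝ T = (ℓ + 1) * (2 * d - ℓ) / 2 ∧
        φ '' {x | x ∈ U ∧ g x = 0} = φ.target ∩ (T : Set (Fin n → Fin d → ℝ)) := by
  obtain ⟨P, hP⟩ := hpoly
  have hg : ContDiff ℝ ω g := contDiff_of_eq_eval hP
  have hgγ : ∀ w, g (orbitMap p w) = 0 := fun w =>
    (hinv _ (transpose_exp_mul_exp_of_skew (transpose_sub_transpose w.1)) w.2 p).trans hp
  have hγ := hasStrictFDerivAt_orbitMap p
  have hA : HasFDerivAt g (fderiv ℝ g p) (orbitMap p 0) := by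
    rw [orbitMap_zero]
    exact (hg.differentiable (by simp) p).hasFDerivAt
  have hker : LinearMap.ker (fderiv ℝ g p).toLinearMap = trivialFlexes p := by
    ext v
    constructor
    · exact fun hv => mem_trivialFlexes.2 (hinfrig v hv)
    · intro hv
      obtain ⟨w, rfl⟩ := exists_antisymmetrization_of_mem_trivialFlexes hv
      have hconst : g ∘ orbitMap p = fun _ => 0 := funext hgγ
      have h1 := hA.comp 0 hγ.hasFDerivAt
      rw [hconst] at h1
      exact congrArg (fun M => M w) (h1.unique (hasFDerivAt_const _ _))
  obtain ⟨U, hUo, hpU, φ, hsrc, hφ, hφs, himg⟩ :=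
    exists_sliceChart_of_ker_le_range hg hA hγ hgγ fun v hv =>
      exists_antisymmetrization_of_mem_trivialFlexes (mem_trivialFlexes.2 (hinfrig v hv))
  rw [orbitMap_zero] at hpU
  refine ⟨U, hUo, hpU, φ, trivialFlexes p, hsrc, hφ, hφs, ?_, hker ▸ himg⟩
  rw [finrank_trivialFlexes hn, hℓ]

end Main
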